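/- Replica symmetric instance of the nonexistence result (combination of equations (2.5) and (2.6) in the proof of Theorem 2.1 of the paper): There is no c with 0 < c ≤ 1 such that both E[tanh²(w √(ξ'(c)))] = c and ξ''(c) · E[cosh^{−4}(w √(ξ'(c)))] ≤ 1 hold, where w is a standard Gaussian random variable. -/

import Mathlib

open MeasureTheory ProbabilityTheory Real

/-- First derivative `ξ'(x) = ∑_{p ≥ 1} 2p β_p² x^{2p−1}`. -/
noncomputable def xiD (β : ℕ → ℝ) (x : ℝ) : ℝ :=
  ∑' p : ℕ, (2 * (p + 1) : ℝ) * (β (p + 1)) ^ 2 * x ^ (2 * (p + 1) - 1)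

/-- Second derivative `ξ''(x) = ∑_{p ≥ 1} 2p(2p−1) β_p² x^{2p−2}`. -/
noncomputable def xiDD (β : ℕ → ℝ) (x : ℝ) : ℝ :=
  ∑' p : ℕ, (2 * (p + 1) : ℝ) * (2 * (p + 1) - 1 : ℝ) * (β (p + 1)) ^ 2 * x ^ (2 * (p + 1) - 2)


lemma aux_hasDerivAt_tanh (y : ℝ) : HasDerivAt Real.tanh (1 - Real.tanh y ^ 2) y := by
  have h := (Real.hasDerivAt_sinh y).div (Real.hasDerivAt_cosh y) (Real.cosh_pos y).ne'
  have e : (Real.sinh / Real.cosh) = Real.tanh := by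
    funext z; simp [Real.tanh_eq_sinh_div_cosh]
  rw [e] at h
  refine h.congr_deriv ?_
  have := (Real.cosh_pos y).ne'
  rw [Real.tanh_eq_sinh_div_cosh]
  field_simp

lemma aux_tanh_sq_lt (y : ℝ) : Real.tanh y ^ 2 < 1 := by
  have := Real.cosh_pos y
  rw [Real.tanh_eq_sinh_div_cosh, div_pow, div_lt_one (by positivity)]
  nlinarith [Real.cosh_sq y]

lemma aux_sech (y : ℝ) : (Real.cosh y ^ 4)⁻¹ = (1 - Real.tanh y ^ 2) ^ 2 := by
  have := (Real.cosh_pos y).ne'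
  have h2 := Real.cosh_sq y
  have : 1 - Real.tanh y ^ 2 = (Real.cosh y ^ 2)⁻¹ := by
    rw [Real.tanh_eq_sinh_div_cosh]
    field_simp
    linarith
  rw [this, inv_pow]; ring_nf

lemma aux_tanh_cont : Continuous Real.tanh :=
  continuous_iff_continuousAt.2 fun y => (aux_hasDerivAt_tanh y).continuousAt

lemma aux_strictMono : StrictMonoOn (fun y : ℝ => y - 3 * Real.tanh y / (3 - Real.tanh y ^ 2))
    (Set.Ici 0) := by
  have hd : ∀ y : ℝ, HasDerivAt (fun y : ℝ => y - 3 * Real.tanh y / (3 - Real.tanh y ^ 2))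
      (4 * Real.tanh y ^ 4 / (3 - Real.tanh y ^ 2) ^ 2) y := by
    intro y
    have hne : 3 - Real.tanh y ^ 2 ≠ 0 := by linarith [aux_tanh_sq_lt y]
    have h := (hasDerivAt_id y).sub (((aux_hasDerivAt_tanh y).const_mul 3).div
      (((aux_hasDerivAt_tanh y).pow 2).const_sub 3) hne)
    refine h.congr_deriv ?_
    simp only [Pi.pow_apply]
    push_cast
    field_simp
    ring
  apply strictMonoOn_of_deriv_pos (convex_Ici 0)
  · exact fun y _ => (hd y).continuousAt.continuousWithinAt
  · intro y hy
    rw [interior_Ici] at hy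
    rw [(hd y).deriv]
    have hne : 0 < 3 - Real.tanh y ^ 2 := by linarith [aux_tanh_sq_lt y]
    have : 0 < Real.tanh y := by
      rw [Real.tanh_eq_sinh_div_cosh]
      exact div_pos (Real.sinh_pos_iff.2 hy) (Real.cosh_pos y)
    positivity

lemma aux_pt_pos {y : ℝ} (hy : 0 < y) :
    0 < y * (Real.tanh y - Real.tanh y ^ 3 / 3) - Real.tanh y ^ 2 := by
  have h := aux_strictMono (Set.self_mem_Ici) (Set.mem_Ici.2 hy.le) hy
  have hne : 0 < 3 - Real.tanh y ^ 2 := by linarith [aux_tanh_sq_lt y]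
  have ht : 0 < Real.tanh y := by
    rw [Real.tanh_eq_sinh_div_cosh]
    exact div_pos (Real.sinh_pos_iff.2 hy) (Real.cosh_pos y)
  simp only [Real.tanh_zero] at h
  norm_num at h
  rw [div_lt_iff₀ hne] at h
  nlinarith [mul_lt_mul_of_pos_right h ht]

lemma aux_pt_nonneg (y : ℝ) :
    0 ≤ y * (Real.tanh y - Real.tanh y ^ 3 / 3) - Real.tanh y ^ 2 := by
  rcases lt_trichotomy y 0 with h | h | h
  · have := aux_pt_pos (y := -y) (by linarith)
    rw [Real.tanh_neg] at this
    nlinarith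
  · simp [h]
  · exact (aux_pt_pos h).le

lemma aux_phi_int : Integrable (fun x : ℝ => Real.exp (-(1/2) * x ^ 2)) :=
  integrable_exp_neg_mul_sq (by norm_num)

lemma aux_xphi_int : Integrable (fun x : ℝ => x * Real.exp (-(1/2) * x ^ 2)) :=
  integrable_mul_exp_neg_mul_sq (by norm_num)

lemma aux_g_bound (y : ℝ) : ‖Real.tanh y - Real.tanh y ^ 3 / 3‖ ≤ 2 := by
  have h := aux_tanh_sq_lt y
  have h1 : |Real.tanh y| ≤ 1 := by
    rw [← sq_le_one_iff_abs_le_one]; exact h.le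
  have e : Real.tanh y - Real.tanh y ^ 3 / 3 = Real.tanh y * (1 - Real.tanh y ^ 2 / 3) := by ring
  have h2 : |1 - Real.tanh y ^ 2 / 3| ≤ 1 := by
    rw [abs_le]; constructor <;> nlinarith [sq_nonneg (Real.tanh y)]
  rw [e, Real.norm_eq_abs, abs_mul]
  nlinarith [abs_nonneg (Real.tanh y), abs_nonneg (1 - Real.tanh y ^ 2 / 3)]

lemma aux_main_exp (r : ℝ) (hr : 0 < r) :
    ∫ x : ℝ, Real.tanh (x * r) ^ 2 * Real.exp (-(1/2) * x ^ 2) <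
      r ^ 2 * ∫ x : ℝ, (1 - Real.tanh (x * r) ^ 2) ^ 2 * Real.exp (-(1/2) * x ^ 2) := by
  have ct : Continuous fun x : ℝ => Real.tanh (x * r) := aux_tanh_cont.comp (by fun_prop)
  have i1 : Integrable fun x : ℝ => Real.tanh (x * r) ^ 2 * Real.exp (-(1/2) * x ^ 2) := by
    refine aux_phi_int.bdd_mul (c := 1) (Continuous.aestronglyMeasurable (by fun_prop)) (ae_of_all _ fun x => ?_)
    rw [Real.norm_eq_abs, abs_of_nonneg (by positivity)]
    exact (aux_tanh_sq_lt _).le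
  have i2 : Integrable fun x : ℝ =>
      (1 - Real.tanh (x * r) ^ 2) ^ 2 * Real.exp (-(1/2) * x ^ 2) := by
    refine aux_phi_int.bdd_mul (c := 1) (Continuous.aestronglyMeasurable (by fun_prop)) (ae_of_all _ fun x => ?_)
    rw [Real.norm_eq_abs, abs_of_nonneg (by positivity)]
    nlinarith [aux_tanh_sq_lt (x * r), sq_nonneg (Real.tanh (x * r))]
  have i3 : Integrable fun x : ℝ => (Real.tanh (x * r) - Real.tanh (x * r) ^ 3 / 3) *
      (x * Real.exp (-(1/2) * x ^ 2)) :=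
    aux_xphi_int.bdd_mul (c := 2) (Continuous.aestronglyMeasurable (by fun_prop)) (ae_of_all _ fun x => aux_g_bound _)
  have i4 : Integrable fun x : ℝ => (Real.tanh (x * r) - Real.tanh (x * r) ^ 3 / 3) *
      Real.exp (-(1/2) * x ^ 2) :=
    aux_phi_int.bdd_mul (c := 2) (Continuous.aestronglyMeasurable (by fun_prop)) (ae_of_all _ fun x => aux_g_bound _)
  have hd : ∀ x : ℝ, HasDerivAt (fun x : ℝ => (Real.tanh (x * r) - Real.tanh (x * r) ^ 3 / 3) *
      Real.exp (-(1/2) * x ^ 2))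
      (r * ((1 - Real.tanh (x * r) ^ 2) ^ 2 * Real.exp (-(1/2) * x ^ 2)) -
        (Real.tanh (x * r) - Real.tanh (x * r) ^ 3 / 3) * (x * Real.exp (-(1/2) * x ^ 2))) x := by
    intro x
    have h1 : HasDerivAt (fun x : ℝ => Real.tanh (x * r)) ((1 - Real.tanh (x * r) ^ 2) * r) x := by
      have := (aux_hasDerivAt_tanh (x * r)).comp x ((hasDerivAt_id x).mul_const r)
      exact this.congr_deriv (by simp)
    have h2 : HasDerivAt (fun x : ℝ => Real.exp (-(1/2) * x ^ 2))
        (Real.exp (-(1/2) * x ^ 2) * (-x)) x := by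
      have := ((hasDerivAt_pow 2 x).const_mul (-(1/2) : ℝ)).exp
      refine this.congr_deriv ?_
      push_cast
      ring
    have h3 := (h1.sub ((h1.pow 3).div_const 3)).mul h2
    refine h3.congr_deriv ?_
    simp only [Pi.sub_apply, Pi.pow_apply]
    push_cast
    ring
  have ibp := integral_eq_zero_of_hasDerivAt_of_integrable hd ((i2.const_mul r).sub i3) i4
  rw [integral_sub (i2.const_mul r) i3, integral_const_mul] at ibp
  have pos : 0 < ∫ x : ℝ, (r * ((Real.tanh (x * r) - Real.tanh (x * r) ^ 3 / 3) *
      (x * Real.exp (-(1/2) * x ^ 2))) - Real.tanh (x * r) ^ 2 * Real.exp (-(1/2) * x ^ 2)) := by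
    have e : ∀ x : ℝ, r * ((Real.tanh (x * r) - Real.tanh (x * r) ^ 3 / 3) *
      (x * Real.exp (-(1/2) * x ^ 2))) - Real.tanh (x * r) ^ 2 * Real.exp (-(1/2) * x ^ 2) =
      ((x * r) * (Real.tanh (x * r) - Real.tanh (x * r) ^ 3 / 3) - Real.tanh (x * r) ^ 2) *
        Real.exp (-(1/2) * x ^ 2) := fun x => by ring
    refine integral_pos_of_integrable_nonneg_nonzero (x := 1) (by fun_prop)
      ((i3.const_mul r).sub i1) (fun x => ?_) ?_
    · simp only [Pi.zero_apply]
      rw [e]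
      exact mul_nonneg (aux_pt_nonneg _) (Real.exp_pos _).le
    · rw [e]
      exact (mul_pos (aux_pt_pos (by linarith)) (Real.exp_pos _)).ne'
  rw [integral_sub (i3.const_mul r) i1, integral_const_mul] at pos
  nlinarith

lemma aux_gauss (f : ℝ → ℝ) : ∫ x, f x ∂(gaussianReal 0 1) =
    (√(2 * π))⁻¹ * ∫ x : ℝ, f x * Real.exp (-(1/2) * x ^ 2) := by
  rw [integral_gaussianReal_eq_integral_smul (by norm_num), ← integral_const_mul]
  congr 1
  funext x
  simp only [gaussianPDFReal, smul_eq_mul]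
  simp
  ring_nf

lemma aux_main (s : ℝ) (hs : 0 < s) :
    ∫ x, (Real.tanh (x * √s)) ^ 2 ∂(gaussianReal 0 1) <
      s * ∫ x, ((Real.cosh (x * √s)) ^ 4)⁻¹ ∂(gaussianReal 0 1) := by
  have h := aux_main_exp (√s) (Real.sqrt_pos.2 hs)
  rw [Real.sq_sqrt hs.le] at h
  simp only [aux_sech]
  rw [aux_gauss, aux_gauss, mul_left_comm]
  exact mul_lt_mul_of_pos_left h (by positivity)

lemma aux_coef (p : ℕ) : (2 * (p + 1) : ℝ) * (2 * (p + 1) - 1 : ℝ) ≤ 4 * 2 ^ (2 * (p + 1)) := by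
  have h : ((p + 1 : ℕ) : ℝ) < 2 ^ (p + 1) := by exact_mod_cast Nat.lt_two_pow_self
  push_cast at h
  have hp : (0 : ℝ) ≤ p := p.cast_nonneg
  rw [mul_comm 2 (p + 1), pow_mul]
  nlinarith

lemma aux_sumDD (β : ℕ → ℝ)
    (hβsum : Summable fun p : ℕ => (2 : ℝ) ^ (2 * (p + 1)) * (β (p + 1)) ^ 2)
    (c : ℝ) (h0 : 0 < c) (h1 : c ≤ 1) : Summable fun p : ℕ =>
    (2 * (p + 1) : ℝ) * (2 * (p + 1) - 1 : ℝ) * (β (p + 1)) ^ 2 * c ^ (2 * (p + 1) - 2) := by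
  refine Summable.of_nonneg_of_le (fun p => ?_) (fun p => ?_) (hβsum.mul_left 4)
  · have : (0 : ℝ) ≤ 2 * (p + 1) - 1 := by linarith [(p.cast_nonneg : (0 : ℝ) ≤ p)]
    positivity
  · have h2 : c ^ (2 * (p + 1) - 2) ≤ 1 := pow_le_one₀ h0.le h1
    have : (0 : ℝ) ≤ 2 * (p + 1) - 1 := by linarith [(p.cast_nonneg : (0 : ℝ) ≤ p)]
    calc _ ≤ (2 * (p + 1) : ℝ) * (2 * (p + 1) - 1 : ℝ) * (β (p + 1)) ^ 2 * 1 := by gcongr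
      _ ≤ (4 * 2 ^ (2 * (p + 1))) * (β (p + 1)) ^ 2 * 1 := by
        have := mul_le_mul_of_nonneg_right (aux_coef p) (sq_nonneg (β (p + 1)))
        linarith
      _ = _ := by ring

lemma aux_term (β : ℕ → ℝ) (c : ℝ) (h0 : 0 < c) (p : ℕ) :
    (2 * (p + 1) : ℝ) * (β (p + 1)) ^ 2 * c ^ (2 * (p + 1) - 1) ≤
    c * ((2 * (p + 1) : ℝ) * (2 * (p + 1) - 1 : ℝ) * (β (p + 1)) ^ 2 * c ^ (2 * (p + 1) - 2)) := by
  have e : 2 * (p + 1) - 1 = 2 * (p + 1) - 2 + 1 := by omega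
  rw [e, pow_succ c]
  have hp : (0 : ℝ) ≤ p := p.cast_nonneg
  have : 0 ≤ (2 * (p + 1) : ℝ) * (β (p + 1)) ^ 2 * c ^ (2 * (p + 1) - 2) * c := by positivity
  have h3 := mul_nonneg this hp
  have e2 : c * ((2 * (p + 1) : ℝ) * (2 * (p + 1) - 1 : ℝ) * (β (p + 1)) ^ 2 *
      c ^ (2 * (p + 1) - 2)) = (2 * (p + 1) : ℝ) * (β (p + 1)) ^ 2 * c ^ (2 * (p + 1) - 2) * c +
      2 * ((2 * (p + 1) : ℝ) * (β (p + 1)) ^ 2 * c ^ (2 * (p + 1) - 2) * c * p) := by ring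
  rw [e2]
  linarith

/-- **Replica symmetric instance of the nonexistence result** (combination of (2.5) and (2.6)
in the proof of Theorem 2.1 of "Chaos in the mixed even-spin models"): there is no
`0 < c ≤ 1` such that `E[tanh²(w √(ξ'(c)))] = c` and `ξ''(c) E[cosh⁻⁴(w √(ξ'(c)))] ≤ 1`,
where `w` is a standard Gaussian random variable. -/
theorem no_replica_symmetric_stationary_point
    (β : ℕ → ℝ)
    (hβsum : Summable fun p : ℕ => (2 : ℝ) ^ (2 * (p + 1)) * (β (p + 1)) ^ 2)
    (hβne : ∃ p : ℕ, 1 ≤ p ∧ β p ≠ 0) :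
    ¬ ∃ c : ℝ, 0 < c ∧ c ≤ 1 ∧
      (∫ x, (Real.tanh (x * Real.sqrt (xiD β c))) ^ 2 ∂(gaussianReal 0 1) = c) ∧
      (xiDD β c * ∫ x, ((Real.cosh (x * Real.sqrt (xiD β c))) ^ 4)⁻¹ ∂(gaussianReal 0 1) ≤ 1) := by
  rintro ⟨c, h0, h1, hA, hB⟩
  have sDD := aux_sumDD β hβsum c h0 h1
  have hnn : ∀ p : ℕ, 0 ≤ (2 * (p + 1) : ℝ) * (β (p + 1)) ^ 2 * c ^ (2 * (p + 1) - 1) :=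
    fun p => by positivity
  have sD : Summable fun p : ℕ => (2 * (p + 1) : ℝ) * (β (p + 1)) ^ 2 * c ^ (2 * (p + 1) - 1) :=
    Summable.of_nonneg_of_le hnn (aux_term β c h0) (sDD.mul_left c)
  have hle : xiD β c ≤ c * xiDD β c := by
    unfold xiD xiDD
    rw [← tsum_mul_left]
    exact sD.tsum_le_tsum (aux_term β c h0) (sDD.mul_left c)
  have hpos : 0 < xiD β c := by
    obtain ⟨p, hp, hb⟩ := hβne
    obtain ⟨q, rfl⟩ : ∃ q, p = q + 1 := ⟨p - 1, by omega⟩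
    exact sD.tsum_pos hnn q (by positivity)
  have hm := aux_main _ hpos
  rw [hA] at hm
  have hI : 0 ≤ ∫ x, ((Real.cosh (x * Real.sqrt (xiD β c))) ^ 4)⁻¹ ∂(gaussianReal 0 1) :=
    integral_nonneg fun x => by positivity
  have h3 := mul_le_mul_of_nonneg_right hle hI
  have h4 := mul_le_mul_of_nonneg_left hB h0.le
  nlinarith
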